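/- Let ε_n = [n even]. For n ≥ 2 define the partitioning cost of the dual-pivot quicksort strategy 'Count' by p_n = (3/2)n − 9/4 + 1/(4(n − ε_n)) + y_n, where y_n = (1/2)·H^odd_{n−2} − 1/8 + (−1)^n/(8(n − ε_n)). Define c : ℕ → ℚ by c_0 = c_1 = 0 and, for n ≥ 2, by the dual-pivot quicksort recurrence c_n = p_n + (3/C(n,2)) · Σ_{k=1}^{n−2} (n−1−k) · c_k. Then for every n ≥ 4, c_n = (9/5)·n·H_n − (1/5)·n·H^alt_n − (89/25)·n + (67/40)·H_n − (3/40)·H^alt_n − 83/800 + (−1)^n/10 − r_n, where r_n = ([n even]/320)·(1/(n−3) + 3/(n−1)) − ([n odd]/320)·(3/(n−2) + 1/n). -/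

import Mathlib

/-- The harmonic number `H_n = ∑_{m=1}^n 1/m`. -/
def H (n : ℕ) : ℚ := ∑ m ∈ Finset.Icc 1 n, (1 : ℚ) / m

/-- The odd harmonic number `H^odd_n = ∑_{m=1}^n [m odd]/m`. -/
def Hodd (n : ℕ) : ℚ := ∑ m ∈ Finset.Icc 1 n, if Odd m then (1 : ℚ) / m else 0

/-- The alternating harmonic number `H^alt_n = ∑_{m=1}^n (−1)^m/m`. -/
def Halt (n : ℕ) : ℚ := ∑ m ∈ Finset.Icc 1 n, (-1 : ℚ) ^ m / m

/-- `ε_n = [n even]`. -/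
def eps (n : ℕ) : ℚ := if Even n then 1 else 0

/-- `y_n = E[X^↗_n]`, the expected number of up-to-zero situations. -/
def y (n : ℕ) : ℚ :=
  (1 / 2) * Hodd (n - 2) - 1 / 8 + (-1 : ℚ) ^ n / (8 * ((n : ℚ) - eps n))

/-- Partitioning cost of strategy "Count". -/
def p (n : ℕ) : ℚ := (3 / 2) * (n : ℚ) - 9 / 4 + 1 / (4 * ((n : ℚ) - eps n)) + y n

/-- The remainder term `r_n`. -/
def r (n : ℕ) : ℚ :=
  (if Even n then (1 : ℚ) / 320 else 0) * (1 / ((n : ℚ) - 3) + 3 / ((n : ℚ) - 1))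
    - (if Odd n then (1 : ℚ) / 320 else 0) * (3 / ((n : ℚ) - 2) + 1 / (n : ℚ))

lemma H_succ (n : ℕ) : H (n+1) = H n + 1 / ((n:ℚ)+1) := by
  unfold H; rw [Finset.sum_Icc_succ_top (by omega)]; push_cast; rfl

lemma Halt_succ (n : ℕ) : Halt (n+1) = Halt n + (-1:ℚ)^(n+1) / ((n:ℚ)+1) := by
  unfold Halt; rw [Finset.sum_Icc_succ_top (by omega)]; push_cast; rfl

lemma Hodd_eq (n : ℕ) : Hodd n = (H n - Halt n) / 2 := by
  unfold Hodd H Halt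
  rw [← Finset.sum_sub_distrib, Finset.sum_div]
  refine Finset.sum_congr rfl fun m _ => ?_
  rcases Nat.even_or_odd m with h | h
  · rw [if_neg (Nat.not_odd_iff_even.mpr h), h.neg_one_pow]; ring
  · rw [if_pos h, h.neg_one_pow]; ring

def TT (c : ℕ → ℚ) (n : ℕ) : ℚ := ∑ k ∈ Finset.Icc 1 (n - 2), ((n - 1 - k : ℕ) : ℚ) * c k

lemma TT_succ (c : ℕ → ℚ) (n : ℕ) :
    TT c (n+3) = TT c (n+2) + ∑ k ∈ Finset.Icc 1 (n+1), c k := by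
  unfold TT
  simp only [show n + 3 - 2 = n + 1 by omega, show n + 2 - 2 = n by omega]
  rw [Finset.sum_Icc_succ_top (by omega), Finset.sum_Icc_succ_top (by omega), ← add_assoc,
    ← Finset.sum_add_distrib]
  congr 1
  · refine Finset.sum_congr rfl fun k hk => ?_
    rw [Finset.mem_Icc] at hk
    rw [show n + 3 - 1 - k = (n + 2 - 1 - k) + 1 by omega]
    push_cast; ring
  · rw [show n + 3 - 1 - (n+1) = 1 by omega]; simp

lemma TT_two (c : ℕ → ℚ) (n : ℕ) :
    TT c (n+4) = 2 * TT c (n+3) - TT c (n+2) + c (n+2) := by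
  have a := TT_succ c n
  have b := TT_succ c (n+1)
  rw [Finset.sum_Icc_succ_top (by omega)] at b
  simp only [show n + 1 + 3 = n + 4 by omega, show n + 1 + 2 = n + 3 by omega, show n + 1 + 1 = n + 2 by omega] at b
  linarith

def ff (n : ℕ) : ℚ := (9 / 5) * (n : ℚ) * H n - (1 / 5) * (n : ℚ) * Halt n - (89 / 25) * (n : ℚ)
        + (67 / 40) * H n - (3 / 40) * Halt n - 83 / 800 + (-1 : ℚ) ^ n / 10 - r n

lemma ch (n : ℕ) : (((n+2).choose 2 : ℕ) : ℚ) = ((n:ℚ)+2)*(n+1)/2 := by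
  rw [Nat.cast_choose_two]; push_cast; ring

lemma key (n : ℕ) :
   ((n:ℚ)+6)*(n+5) * (ff (n+6) - p (n+6)) = 2 * (((n:ℚ)+5)*(n+4) * (ff (n+5) - p (n+5)))
     - ((n:ℚ)+4)*(n+3) * (ff (n+4) - p (n+4)) + 6 * ff (n+4) := by
  have e1 : (n:ℚ)+1 ≠ 0 := by positivity
  have e2 : (n:ℚ)+2 ≠ 0 := by positivity
  have e3 : (n:ℚ)+3 ≠ 0 := by positivity
  have e4 : (n:ℚ)+4 ≠ 0 := by positivity
  have e5 : (n:ℚ)+5 ≠ 0 := by positivity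
  have e6 : (n:ℚ)+6 ≠ 0 := by positivity
  have a1 : Halt (n+3) = Halt (n+2) + (-1:ℚ)^(n+3) / ((n:ℚ)+3) := by
    rw [Halt_succ (n+2)]; push_cast; ring
  have a2 : Halt (n+4) = Halt (n+3) + (-1:ℚ)^(n+4) / ((n:ℚ)+4) := by
    rw [Halt_succ (n+3)]; push_cast; ring
  have a3 : Halt (n+5) = Halt (n+4) + (-1:ℚ)^(n+5) / ((n:ℚ)+5) := by
    rw [Halt_succ (n+4)]; push_cast; ring
  have a4 : Halt (n+6) = Halt (n+5) + (-1:ℚ)^(n+6) / ((n:ℚ)+6) := by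
    rw [Halt_succ (n+5)]; push_cast; ring
  have b1 : H (n+3) = H (n+2) + 1 / ((n:ℚ)+3) := by
    rw [H_succ (n+2)]; push_cast; ring
  have b2 : H (n+4) = H (n+3) + 1 / ((n:ℚ)+4) := by
    rw [H_succ (n+3)]; push_cast; ring
  have b3 : H (n+5) = H (n+4) + 1 / ((n:ℚ)+5) := by
    rw [H_succ (n+4)]; push_cast; ring
  have b4 : H (n+6) = H (n+5) + 1 / ((n:ℚ)+6) := by
    rw [H_succ (n+5)]; push_cast; ring
  unfold ff p y
  simp only [show n+6-2 = n+4 by omega, show n+5-2 = n+3 by omega, show n+4-2 = n+2 by omega, Hodd_eq]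
  rw [a4, a3, a2, a1, b4, b3, b2, b1]
  generalize Halt (n+2) = A
  generalize H (n+2) = B
  unfold r eps
  have s6 : (n:ℚ)+6-3 = n+3 := by ring
  have s61 : (n:ℚ)+6-1 = n+5 := by ring
  have s62 : (n:ℚ)+6-2 = n+4 := by ring
  have s5 : (n:ℚ)+5-3 = n+2 := by ring
  have s51 : (n:ℚ)+5-1 = n+4 := by ring
  have s52 : (n:ℚ)+5-2 = n+3 := by ring
  have s4 : (n:ℚ)+4-3 = n+1 := by ring
  have s41 : (n:ℚ)+4-1 = n+3 := by ring
  have s42 : (n:ℚ)+4-2 = n+2 := by ring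
  rcases Nat.even_or_odd n with h | h
  · have p4 : Even (n+4) := h.add (by decide)
    have p6 : Even (n+6) := h.add (by decide)
    have p5 : Odd (n+5) := h.add_odd (by decide)
    have q4 := Nat.not_odd_iff_even.mpr p4
    have q6 := Nat.not_odd_iff_even.mpr p6
    have q5 := Nat.not_even_iff_odd.mpr p5
    have t3 : Odd (n+3) := h.add_odd (by decide)
    simp only [p4, p6, p5, q4, q6, q5, if_true, if_false, p4.neg_one_pow, p6.neg_one_pow, p5.neg_one_pow, t3.neg_one_pow]
    push_cast
    simp only [s6, s61, s62, s5, s51, s52, s4, s41, s42, sub_zero]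
    field_simp
    ring
  · have p4 : Odd (n+4) := h.add_even (by decide)
    have p6 : Odd (n+6) := h.add_even (by decide)
    have p5 : Even (n+5) := h.add_odd (by decide)
    have q4 := Nat.not_even_iff_odd.mpr p4
    have q6 := Nat.not_even_iff_odd.mpr p6
    have q5 := Nat.not_odd_iff_even.mpr p5
    have t3 : Even (n+3) := h.add_odd (by decide)
    simp only [p4, p6, p5, q4, q6, q5, if_true, if_false, p4.neg_one_pow, p6.neg_one_pow, p5.neg_one_pow, t3.neg_one_pow]
    push_cast
    simp only [s6, s61, s62, s5, s51, s52, s4, s41, s42, sub_zero]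
    field_simp
    ring

/-- The exact average number of comparisons of the dual-pivot quicksort algorithm
"Count": if `c` satisfies `c_0 = c_1 = 0` and the dual-pivot quicksort recurrence
`c_n = p_n + (3/C(n,2))·Σ_{k=1}^{n−2}(n−1−k)·c_k` for `n ≥ 2`, then for `n ≥ 4`,
`c_n = (9/5)nH_n − (1/5)nH^alt_n − (89/25)n + (67/40)H_n − (3/40)H^alt_n
  − 83/800 + (−1)^n/10 − r_n`. -/
theorem count_cost (c : ℕ → ℚ) (h0 : c 0 = 0) (h1 : c 1 = 0)
    (hrec : ∀ n, 2 ≤ n →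
      c n = p n + (3 / (n.choose 2 : ℚ)) *
        ∑ k ∈ Finset.Icc 1 (n - 2), ((n - 1 - k : ℕ) : ℚ) * c k) :
    ∀ n, 4 ≤ n →
      c n = (9 / 5) * (n : ℚ) * H n - (1 / 5) * (n : ℚ) * Halt n - (89 / 25) * (n : ℚ)
        + (67 / 40) * H n - (3 / 40) * Halt n - 83 / 800 + (-1 : ℚ) ^ n / 10 - r n := by
  have hT : ∀ n : ℕ, ((n:ℚ)+2)*(n+1) * (c (n+2) - p (n+2)) = 6 * TT c (n+2) := by
    intro n
    have := hrec (n+2) (by omega)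
    change _ = _ + _ * TT c (n+2) at this
    rw [ch] at this
    rw [this]
    have e1 : (n:ℚ)+1 ≠ 0 := by positivity
    have e2 : (n:ℚ)+2 ≠ 0 := by positivity
    field_simp
    ring
  have T2 : TT c 2 = 0 := by simp [TT]
  have T3 : TT c 3 = 0 := by simp [TT, h1]
  have T4 := TT_two c 0
  have T5 := TT_two c 1
  have k2 := hT 0
  have k3 := hT 1
  have k4 := hT 2
  have k5 := hT 3
  have E0 : Even 0 := by decide
  have E1 : ¬ Even 1 := by decide
  have E2 : Even 2 := by decide
  have E3 : ¬ Even 3 := by decide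
  have E4 : Even 4 := by decide
  have E5 : ¬ Even 5 := by decide
  have O1 : Odd 1 := by decide
  have O2 : ¬ Odd 2 := by decide
  have O3 : Odd 3 := by decide
  have O4 : ¬ Odd 4 := by decide
  have O5 : Odd 5 := by decide
  norm_num [T2, T3] at T4 T5 k2 k3 k4 k5
  have P2 : p 2 = 1 := by norm_num [p, y, eps, Hodd, Finset.sum_Icc_succ_top, E2]
  have P3 : p 3 = 8/3 := by norm_num [p, y, eps, Hodd, Finset.sum_Icc_succ_top, E3, O1]
  have F4 : c 4 = ff 4 := by
    norm_num [ff, r, H, Halt, p, y, eps, Hodd, Finset.sum_Icc_succ_top, E2, E3, E4, O1, O2, O3, O4] at k4 ⊢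
    linarith
  have F5 : c 5 = ff 5 := by
    norm_num [ff, r, H, Halt, p, y, eps, Hodd, Finset.sum_Icc_succ_top, E2, E3, E5, O1, O2, O3, O5] at k5 ⊢
    linarith
  have main : ∀ n : ℕ, c (n+4) = ff (n+4) ∧ c (n+5) = ff (n+5) := by
    intro n
    induction n with
    | zero => exact ⟨F4, F5⟩
    | succ n ih =>
      obtain ⟨i1, i2⟩ := ih
      refine ⟨by rw [show n+1+4 = n+5 by omega]; exact i2, ?_⟩
      rw [show n+1+5 = n+6 by omega]
      have K := key n
      have u4 := hT (n+2)
      have u5 := hT (n+3)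
      have u6 := hT (n+4)
      have t := TT_two c (n+2)
      simp only [add_assoc] at u4 u5 u6 t
      norm_num at u4 u5 u6 t
      simp only [add_assoc] at u4 u5 u6 
      norm_num at u4 u5 u6
      rw [i1] at u4 t
      rw [i2] at u5
      have e : ((n:ℚ)+6)*(n+5) ≠ 0 := by positivity
      have : ((n:ℚ)+6)*(n+5) * (c (n+6) - p (n+6)) = ((n:ℚ)+6)*(n+5) * (ff (n+6) - p (n+6)) := by
        rw [K, u4, u5, u6, t]; ring
      have := mul_left_cancel₀ e this
      linarith
  intro n hn
  obtain ⟨m, rfl⟩ := Nat.exists_eq_add_of_le' hn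
  exact (main m).1
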